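/- arXiv:2202.13266 — 3 statements merged into one kernel-verified Lean document; each statement's English description precedes it below -/
import Mathlib

section
/- Let λ, μ, b be real numbers with b ≠ 0 and 2λ + 8μ ≠ 0, let G : Fin 3 → Fin 3 → Fin 3 → ℝ be a third-order tensor satisfying G_ijk = G_jik, and let U : Fin 3 → ℝ be a vector. Define Ṁ_ijk = (b²/5)·[λ·δ_ij·G_hhk + 2μ·G_ijk − 2λ·δ_ij·U_k − 2μ·(δ_ik·U_j + δ_jk·U_i)] (summation over h). Then the trace conditions Ṁ_ijj = 0 (summation over j) hold for every i if and only if U_i = (λ·G_hhi + 2μ·G_ihh)/(2λ + 8μ) for every i. -/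
open scoped BigOperators

/-- The GLPD hypoelastic moment rate
`Ṁ_ijk = (b²/5)[λ δ_ij G_hhk + 2μ G_ijk − 2λ δ_ij U_k − 2μ(δ_ik U_j + δ_jk U_i)]`. -/
noncomputable def Mdot (lam mu b : ℝ) (G : Fin 3 → Fin 3 → Fin 3 → ℝ) (U : Fin 3 → ℝ)
    (i j k : Fin 3) : ℝ :=
  (b^2/5) * (lam * (if i = j then (1:ℝ) else 0) * (∑ h, G h h k)
    + 2*mu * G i j k
    - 2*lam * (if i = j then (1:ℝ) else 0) * U k
    - 2*mu * ((if i = k then (1:ℝ) else 0) * U j + (if j = k then (1:ℝ) else 0) * U i))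

/-- The trace of the moment rate over its last two indices. -/
theorem sum_Mdot_trace (lam mu b : ℝ) (G : Fin 3 → Fin 3 → Fin 3 → ℝ) (U : Fin 3 → ℝ)
    (i : Fin 3) :
    ∑ j : Fin 3, Mdot lam mu b G U i j j =
      (b^2/5) * (lam * (∑ h, G h h i) + 2*mu * (∑ h, G i h h) - U i * (2*lam + 8*mu)) := by
  fin_cases i <;> simp [Mdot, Fin.sum_univ_three] <;> ring

/-- the trace conditions `Ṁ_ijj = 0` hold for every `i` iff
`U_i = (λ G_hhi + 2μ G_ihh)/(2λ + 8μ)` for every `i`. -/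
theorem glpd_trace_condition_iff (lam mu b : ℝ) (hb : b ≠ 0) (hden : 2*lam + 8*mu ≠ 0)
    (G : Fin 3 → Fin 3 → Fin 3 → ℝ) (hG : ∀ i j k, G i j k = G j i k)
    (U : Fin 3 → ℝ) :
    (∀ i : Fin 3, ∑ j : Fin 3, Mdot lam mu b G U i j j = 0)
      ↔ (∀ i : Fin 3,
          U i = (lam * (∑ h, G h h i) + 2*mu * (∑ h, G i h h)) / (2*lam + 8*mu)) := by
  have hb' : b^2/5 ≠ 0 := by positivity
  refine forall_congr' fun i => ?_
  rw [sum_Mdot_trace, mul_eq_zero, or_iff_right hb', sub_eq_zero, eq_div_iff hden, eq_comm]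
end

section
/- Let p ∈ (0,1) and Σ̄ > 0 be real numbers, and let x ≥ 0 and Σ_m be real numbers. Then x/Σ̄² + 2p·cosh((3/2)Σ_m/Σ̄) − 1 − p² = 0 holds if and only if there exists φ ∈ [−π/2, π/2] such that x = (1−p)²·Σ̄²·cos²φ, cosh((3/2)Σ_m/Σ̄) = 1 + (1−p)²·sin²φ/(2p), and Σ_m·φ ≥ 0. -/
/-- parametrization of the GLPD yield locus. For `p ∈ (0,1)`, `Σ̄ > 0`,
`x ≥ 0`, the point `(x, Σ_m)` lies on the yield locus
`x/Σ̄² + 2p cosh((3/2)Σ_m/Σ̄) − 1 − p² = 0` iff there is `φ ∈ [−π/2, π/2]` with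
`x = (1−p)² Σ̄² cos²φ`, `cosh((3/2)Σ_m/Σ̄) = 1 + (1−p)² sin²φ/(2p)`, and `Σ_m φ ≥ 0`. -/
theorem glpd_yield_locus_param (p Sbar : ℝ) (hp : p ∈ Set.Ioo (0:ℝ) 1) (hSbar : 0 < Sbar)
    (x Sm : ℝ) (hx : 0 ≤ x) :
    x / Sbar^2 + 2*p*Real.cosh ((3/2) * Sm / Sbar) - 1 - p^2 = 0 ↔
      ∃ φ ∈ Set.Icc (-(Real.pi/2)) (Real.pi/2),
        x = (1-p)^2 * Sbar^2 * (Real.cos φ)^2 ∧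
        Real.cosh ((3/2) * Sm / Sbar) = 1 + (1-p)^2 * (Real.sin φ)^2 / (2*p) ∧
        0 ≤ Sm * φ := by
  obtain ⟨hp0, hp1⟩ := hp
  have hq : 0 < 1 - p := by linarith
  have hC := Real.one_le_cosh ((3/2) * Sm / Sbar)
  generalize Real.cosh ((3/2) * Sm / Sbar) = C at hC ⊢
  constructor
  · intro h
    set c := √x / ((1 - p) * Sbar) with hc
    have hc0 : 0 ≤ c := by positivity
    have hc_sq : c ^ 2 = x / Sbar ^ 2 / (1 - p) ^ 2 := by
      rw [hc, div_pow, Real.sq_sqrt hx, mul_pow, div_div, mul_comm]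
    have hc1 : c ≤ 1 := by
      rw [← sq_le_one_iff₀ hc0, hc_sq, div_le_one (by positivity)]
      nlinarith
    have hcos : Real.cos (Real.arccos c) = c := Real.cos_arccos (by linarith) hc1
    have hsin : Real.sin (Real.arccos c) ^ 2 = 1 - c ^ 2 := by
      rw [Real.sin_sq, hcos]
    have hφ0 := Real.arccos_nonneg c
    have hφ1 : Real.arccos c ≤ Real.pi / 2 := Real.arccos_le_pi_div_two.2 hc0
    have hx_eq : x = (1 - p) ^ 2 * Sbar ^ 2 * c ^ 2 := by
      rw [hc_sq]
      field_simp
    have hC_eq : C = 1 + (1 - p) ^ 2 * (1 - c ^ 2) / (2 * p) := by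
      have hxc : x / Sbar ^ 2 = (1 - p) ^ 2 * c ^ 2 := by
        rw [hc_sq]
        field_simp
      rw [hxc] at h
      field_simp
      linarith
    rcases le_total 0 Sm with hS | hS
    · exact ⟨Real.arccos c, ⟨by linarith, hφ1⟩, by rwa [hcos], by rwa [hsin],
        mul_nonneg hS hφ0⟩
    · exact ⟨-Real.arccos c, ⟨by linarith, by linarith⟩, by rwa [Real.cos_neg, hcos],
        by rwa [Real.sin_neg, neg_sq, hsin], mul_nonneg_of_nonpos_of_nonpos hS (by linarith)⟩
  · rintro ⟨φ, -, rfl, rfl, -⟩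
    rw [Real.sin_sq]
    field_simp
    ring
end

section
/- Let Σ̄ > 0, b > 0 and p ∈ (0,1) be real numbers. Then the GLPD yield function Φ, regarded as a function of the pair (Σ, M) on the product of the space of 3×3 real matrices and the space of third-order tensors Fin 3 → Fin 3 → Fin 3 → ℝ, is strictly convex on the whole space. -/
open scoped BigOperators

/-- Deviator of a 3×3 real matrix (represented as `Fin 3 → Fin 3 → ℝ`). -/
noncomputable def dev (S : Fin 3 → Fin 3 → ℝ) : Fin 3 → Fin 3 → ℝ :=
  fun i j => S i j - (1/3) * (∑ k, S k k) * (if i = j then (1:ℝ) else 0)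

/-- Mean stress `Σ_m = (1/3) Σ_kk`. -/
noncomputable def meanStress (S : Fin 3 → Fin 3 → ℝ) : ℝ := (1/3) * ∑ k, S k k

/-- von Mises equivalent stress `Σ_eq = ((3/2) Σ'_ij Σ'_ij)^{1/2}`. -/
noncomputable def sigmaEq (S : Fin 3 → Fin 3 → ℝ) : ℝ :=
  Real.sqrt ((3/2) * ∑ i, ∑ j, dev S i j * dev S i j)

/-- Mean part of a third-order tensor over its first two indices: `M_mk = (1/3) M_hhk`. -/
noncomputable def Mmean (M : Fin 3 → Fin 3 → Fin 3 → ℝ) (k : Fin 3) : ℝ :=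
  (1/3) * ∑ h, M h h k

/-- Deviatoric part of a third-order tensor over its first two indices. -/
noncomputable def Mdev (M : Fin 3 → Fin 3 → Fin 3 → ℝ) (i j k : Fin 3) : ℝ :=
  M i j k - (if i = j then (1:ℝ) else 0) * Mmean M k

/-- First quadratic invariant `M_I = M_mi M_mi`. -/
noncomputable def MI (M : Fin 3 → Fin 3 → Fin 3 → ℝ) : ℝ := ∑ i, Mmean M i * Mmean M i

/-- Second quadratic invariant `M_II = (3/2) M'_ijk M'_ijk`. -/
noncomputable def MII (M : Fin 3 → Fin 3 → Fin 3 → ℝ) : ℝ :=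
  (3/2) * ∑ i, ∑ j, ∑ k, Mdev M i j k * Mdev M i j k

/-- `Q² = A_I M_I + A_II M_II` with `A_I = 0.194`, `A_II = 6.108`. -/
noncomputable def Qsq (M : Fin 3 → Fin 3 → Fin 3 → ℝ) : ℝ :=
  0.194 * MI M + 6.108 * MII M

/-- GLPD yield function. -/
noncomputable def Phi (Sbar b p : ℝ) (S : Fin 3 → Fin 3 → ℝ)
    (M : Fin 3 → Fin 3 → Fin 3 → ℝ) : ℝ :=
  ((sigmaEq S)^2 + Qsq M / b^2) / Sbar^2
    + 2 * p * Real.cosh ((3/2) * meanStress S / Sbar) - 1 - p^2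

theorem sq_convex_combination {a c : ℝ} (h : a + c = 1) (x y : ℝ) :
    (a * x + c * y) * (a * x + c * y)
      = a * (x * x) + c * (y * y) - a * c * ((x - y) * (x - y)) := by
  obtain rfl : c = 1 - a := by linarith
  ring

theorem sum_sq_convex_combination {ι : Type*} [Fintype ι] {a c : ℝ} (h : a + c = 1)
    (x y : ι → ℝ) :
    ∑ i, (a * x i + c * y i) * (a * x i + c * y i)
      = a * ∑ i, x i * x i + c * ∑ i, y i * y i
        - a * c * ∑ i, (x i - y i) * (x i - y i) := by
  simp only [sq_convex_combination h, Finset.sum_sub_distrib, Finset.sum_add_distrib,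
    Finset.mul_sum]

theorem strictConvexOn_cosh : StrictConvexOn ℝ Set.univ Real.cosh := by
  refine strictConvexOn_univ_of_deriv2_pos Real.continuous_cosh fun x => ?_
  simp [Real.cosh_pos]

theorem dev_convex_combination (a c : ℝ) (S T : Fin 3 → Fin 3 → ℝ) (i j : Fin 3) :
    dev (a • S + c • T) i j = a * dev S i j + c * dev T i j := by
  simp only [dev, Pi.add_apply, Pi.smul_apply, smul_eq_mul, Fin.sum_univ_three]
  ring

theorem dev_sub (S T : Fin 3 → Fin 3 → ℝ) (i j : Fin 3) :
    dev (S - T) i j = dev S i j - dev T i j := by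
  simp only [dev, Pi.sub_apply, Fin.sum_univ_three]
  ring

theorem meanStress_convex_combination (a c : ℝ) (S T : Fin 3 → Fin 3 → ℝ) :
    meanStress (a • S + c • T) = a * meanStress S + c * meanStress T := by
  simp only [meanStress, Pi.add_apply, Pi.smul_apply, smul_eq_mul, Fin.sum_univ_three]
  ring

theorem meanStress_sub (S T : Fin 3 → Fin 3 → ℝ) :
    meanStress (S - T) = meanStress S - meanStress T := by
  simp only [meanStress, Pi.sub_apply, Fin.sum_univ_three]
  ring

theorem Mmean_convex_combination (a c : ℝ) (M N : Fin 3 → Fin 3 → Fin 3 → ℝ) (k : Fin 3) :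
    Mmean (a • M + c • N) k = a * Mmean M k + c * Mmean N k := by
  simp only [Mmean, Pi.add_apply, Pi.smul_apply, smul_eq_mul, Fin.sum_univ_three]
  ring

theorem Mmean_sub (M N : Fin 3 → Fin 3 → Fin 3 → ℝ) (k : Fin 3) :
    Mmean (M - N) k = Mmean M k - Mmean N k := by
  simp only [Mmean, Pi.sub_apply, Fin.sum_univ_three]
  ring

theorem Mdev_convex_combination (a c : ℝ) (M N : Fin 3 → Fin 3 → Fin 3 → ℝ)
    (i j k : Fin 3) :
    Mdev (a • M + c • N) i j k = a * Mdev M i j k + c * Mdev N i j k := by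
  simp only [Mdev, Mmean_convex_combination, Pi.add_apply, Pi.smul_apply, smul_eq_mul]
  ring

theorem Mdev_sub (M N : Fin 3 → Fin 3 → Fin 3 → ℝ) (i j k : Fin 3) :
    Mdev (M - N) i j k = Mdev M i j k - Mdev N i j k := by
  simp only [Mdev, Mmean_sub, Pi.sub_apply]
  ring

theorem sigmaEq_sq (S : Fin 3 → Fin 3 → ℝ) :
    sigmaEq S ^ 2 = (3/2) * ∑ i, ∑ j, dev S i j * dev S i j :=
  Real.sq_sqrt (mul_nonneg (by norm_num)
    (Finset.sum_nonneg fun _ _ => Finset.sum_nonneg fun _ _ => mul_self_nonneg _))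

theorem sigmaEq_sq_convex_combination {a c : ℝ} (h : a + c = 1) (S T : Fin 3 → Fin 3 → ℝ) :
    sigmaEq (a • S + c • T) ^ 2
      = a * sigmaEq S ^ 2 + c * sigmaEq T ^ 2 - a * c * sigmaEq (S - T) ^ 2 := by
  simp only [sigmaEq_sq, dev_convex_combination, dev_sub, sum_sq_convex_combination h,
    Finset.sum_sub_distrib, Finset.sum_add_distrib, ← Finset.mul_sum]
  ring

theorem eq_zero_of_sigmaEq_eq_zero_of_meanStress_eq_zero {S : Fin 3 → Fin 3 → ℝ}
    (hdev : sigmaEq S = 0) (hmean : meanStress S = 0) : S = 0 := by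
  have hsum : ∑ i, ∑ j, dev S i j * dev S i j = 0 := by
    have := sigmaEq_sq S
    rw [hdev] at this
    linarith
  have htr : ∑ k, S k k = 0 := by
    unfold meanStress at hmean
    linarith
  rw [Finset.sum_eq_zero_iff_of_nonneg
    fun _ _ => Finset.sum_nonneg fun _ _ => mul_self_nonneg _] at hsum
  funext i j
  have hi := hsum i (Finset.mem_univ i)
  rw [Finset.sum_eq_zero_iff_of_nonneg fun _ _ => mul_self_nonneg _] at hi
  simpa [dev, htr] using hi j (Finset.mem_univ j)

theorem Qsq_convex_combination {a c : ℝ} (h : a + c = 1)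
    (M N : Fin 3 → Fin 3 → Fin 3 → ℝ) :
    Qsq (a • M + c • N) = a * Qsq M + c * Qsq N - a * c * Qsq (M - N) := by
  simp only [Qsq, MI, MII, Mmean_convex_combination, Mmean_sub, Mdev_convex_combination,
    Mdev_sub, sum_sq_convex_combination h, Finset.sum_sub_distrib, Finset.sum_add_distrib,
    ← Finset.mul_sum]
  ring

theorem MI_nonneg (M : Fin 3 → Fin 3 → Fin 3 → ℝ) : 0 ≤ MI M :=
  Finset.sum_nonneg fun _ _ => mul_self_nonneg _

theorem MII_nonneg (M : Fin 3 → Fin 3 → Fin 3 → ℝ) : 0 ≤ MII M :=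
  mul_nonneg (by norm_num) (Finset.sum_nonneg fun _ _ => Finset.sum_nonneg fun _ _ =>
    Finset.sum_nonneg fun _ _ => mul_self_nonneg _)

theorem Qsq_nonneg (M : Fin 3 → Fin 3 → Fin 3 → ℝ) : 0 ≤ Qsq M :=
  add_nonneg (mul_nonneg (by norm_num) (MI_nonneg M)) (mul_nonneg (by norm_num) (MII_nonneg M))

theorem eq_zero_of_Qsq_eq_zero {M : Fin 3 → Fin 3 → Fin 3 → ℝ} (h : Qsq M = 0) : M = 0 := by
  have hI := MI_nonneg M
  have hII := MII_nonneg M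
  unfold Qsq at h
  have hI0 : MI M = 0 := by linarith
  have hII0 : MII M = 0 := by linarith
  have hmean : ∀ k, Mmean M k = 0 := by
    intro k
    rw [MI, Finset.sum_eq_zero_iff_of_nonneg fun _ _ => mul_self_nonneg _] at hI0
    exact mul_self_eq_zero.mp (hI0 k (Finset.mem_univ k))
  have hsum : ∑ i, ∑ j, ∑ k, Mdev M i j k * Mdev M i j k = 0 := by
    unfold MII at hII0
    linarith
  rw [Finset.sum_eq_zero_iff_of_nonneg fun _ _ => Finset.sum_nonneg fun _ _ =>
    Finset.sum_nonneg fun _ _ => mul_self_nonneg _] at hsum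
  funext i j k
  have hi := hsum i (Finset.mem_univ i)
  rw [Finset.sum_eq_zero_iff_of_nonneg
    fun _ _ => Finset.sum_nonneg fun _ _ => mul_self_nonneg _] at hi
  have hij := hi j (Finset.mem_univ j)
  rw [Finset.sum_eq_zero_iff_of_nonneg fun _ _ => mul_self_nonneg _] at hij
  simpa [Mdev, hmean] using hij k (Finset.mem_univ k)

/-- the GLPD yield function `(Σ, M) ↦ Φ(Σ, M)` is strictly convex on the
whole product space of 3×3 matrices and third-order tensors. -/
theorem glpd_yield_strictConvex (Sbar b p : ℝ) (hSbar : 0 < Sbar) (hb : 0 < b)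
    (hp : p ∈ Set.Ioo (0:ℝ) 1) :
    StrictConvexOn ℝ
      (Set.univ : Set ((Fin 3 → Fin 3 → ℝ) × (Fin 3 → Fin 3 → Fin 3 → ℝ)))
      (fun q => Phi Sbar b p q.1 q.2) := by
  refine ⟨convex_univ, ?_⟩
  rintro ⟨S, M⟩ - ⟨T, N⟩ - hne a c ha hc hac
  have hp0 : 0 < p := hp.1
  simp only [Prod.smul_mk, Prod.mk_add_mk, smul_eq_mul, Phi]
  set u := (3/2) * meanStress S / Sbar with hu
  set v := (3/2) * meanStress T / Sbar with hv
  have harg : (3/2) * meanStress (a • S + c • T) / Sbar = a * u + c * v := by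
    rw [meanStress_convex_combination, hu, hv]
    ring
  have hcosh : Real.cosh (a * u + c * v) ≤ a * Real.cosh u + c * Real.cosh v :=
    strictConvexOn_cosh.convexOn.2 trivial trivial ha.le hc.le hac
  have hcosh' : u ≠ v → Real.cosh (a * u + c * v) < a * Real.cosh u + c * Real.cosh v :=
    fun huv => strictConvexOn_cosh.2 trivial trivial huv ha hc hac
  rw [harg, sigmaEq_sq_convex_combination hac, Qsq_convex_combination hac]
  set D := (sigmaEq (S - T) ^ 2 + Qsq (M - N) / b ^ 2) / Sbar ^ 2 with hD
  have hQ := Qsq_nonneg (M - N)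
  have hD0 : 0 ≤ D := by positivity
  suffices hgap : 0 < a * c * D
      + 2 * p * (a * Real.cosh u + c * Real.cosh v - Real.cosh (a * u + c * v)) by
    rw [hD] at hgap
    obtain rfl : c = 1 - a := by linarith
    linear_combination hgap
  by_cases huv : u = v
  · have hDpos : 0 < D := by
      refine hD0.lt_of_ne' fun hzero => hne ?_
      have hnum : sigmaEq (S - T) ^ 2 + Qsq (M - N) / b ^ 2 = 0 :=
        (div_eq_zero_iff.mp hzero).resolve_right (by positivity)
      obtain ⟨hσ, hQb⟩ := (add_eq_zero_iff_of_nonneg (sq_nonneg _) (by positivity)).mp hnum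
      have hQ0 : Qsq (M - N) = 0 := (div_eq_zero_iff.mp hQb).resolve_right (by positivity)
      have hmean : meanStress (S - T) = 0 := by
        rw [hu, hv, div_left_inj' hSbar.ne'] at huv
        rw [meanStress_sub]
        linarith
      exact Prod.ext
        (sub_eq_zero.mp (eq_zero_of_sigmaEq_eq_zero_of_meanStress_eq_zero
          (pow_eq_zero_iff two_ne_zero |>.mp hσ) hmean))
        (sub_eq_zero.mp (eq_zero_of_Qsq_eq_zero hQ0))
    exact add_pos_of_pos_of_nonneg (by positivity)
      (mul_nonneg (by positivity) (sub_nonneg.mpr hcosh))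
  · exact add_pos_of_nonneg_of_pos (by positivity)
      (mul_pos (by positivity) (sub_pos.mpr (hcosh' huv)))
end
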